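/- Fix m ≥ 1, a, b_1,…,b_m, c_1,…,c_m ∈ ℂ, set β_{0,i} = b_i, β_{1,i} = c_i − 1 − b_i, Σβ_v = Σ_i β_{v_i,i}, and let σ_j·v be v with the j-th coordinate flipped. Then for every k ∈ {1,…,m}, every v ∈ {0,1}^m with v_k = 1, and all t, x ∈ ℂ^m with x_k·(1 − Σ_i v_i x_i)·(1 − Σ_i t_i x_i)·∏_{i=1}^m t_i(t_i − 1) ≠ 0, one has a t_k / ((1 − Σ_i t_i x_i)·∏_{i=1}^m (t_i − v_i)) = (1/x_k)·[ −β_{0,k}/∏_i (t_i − (σ_k·v)_i) − β_{1,k}/∏_i (t_i − v_i) + ω_{T_k}(t,x)/∏_{i≠k}(t_i − v_i) ] + (1/(1 − Σ_i v_i x_i))·[ (a − Σβ_v)/∏_i (t_i − v_i) − Σ_{j=1}^m β_{1−v_j,j}/∏_i (t_i − (σ_j·v)_i) + Σ_{j=1}^m ω_{T_j}(t,x)/∏_{i≠j}(t_i − v_i) ], where ω_{T_j}(t,x) = β_{0,j}/t_j + β_{1,j}/(t_j − 1) + a x_j/(1 − Σ_i t_i x_i). -/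

import Mathlib

open Finset

/-- `v_i ∈ {0,1}` regarded as a complex number. -/
def bval (s : Bool) : ℂ := if s then 1 else 0

/-- The parameters `β_{0,i} = b_i`, `β_{1,i} = c_i − 1 − b_i`. -/
def betaP {m : ℕ} (b c : Fin m → ℂ) (s : Bool) (i : Fin m) : ℂ :=
  if s then c i - 1 - b i else b i

/-- `ω_{T_j}(t,x) = β_{0,j}/t_j + β_{1,j}/(t_j − 1) + a x_j/(1 − Σ t_i x_i)`. -/
noncomputable def omegaT {m : ℕ} (a : ℂ) (b c : Fin m → ℂ) (t x : Fin m → ℂ) (j : Fin m) : ℂ :=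
  betaP b c false j / t j + betaP b c true j / (t j - 1) + a * x j / (1 - ∑ i, t i * x i)

/-- `σ_j·v` : flip the `j`-th coordinate of `v`. -/
def flipv {m : ℕ} (j : Fin m) (v : Fin m → Bool) : Fin m → Bool :=
  Function.update v j (!(v j))

lemma sub_bval_mul_sub_bval_not (s : Bool) (z : ℂ) :
    (z - bval s) * (z - bval (!s)) = z * (z - 1) := by
  cases s <;> simp [bval, mul_comm]

/-- Flipping the `j`-th coordinate only changes the `j`-th factor of `∏ (t_i - v_i)`. -/
lemma prod_sub_bval_flipv {m : ℕ} (t : Fin m → ℂ) (v : Fin m → Bool) (j : Fin m) :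
    ∏ i, (t i - bval (flipv j v i)) =
      (t j - bval (!(v j))) * ∏ i ∈ univ.erase j, (t i - bval (v i)) := by
  rw [← mul_prod_erase univ _ (mem_univ j)]
  congr 1
  · simp [flipv]
  · refine prod_congr rfl fun i hi => ?_
    rw [flipv, Function.update_of_ne (ne_of_mem_erase hi)]

/-- The contribution of `ω_{T_j}` cancels the pole along the flipped `j`-th coordinate. -/
lemma omegaT_div_prod_erase {m : ℕ} (a : ℂ) (b c t x : Fin m → ℂ) (v : Fin m → Bool)
    (ht : ∀ i, t i * (t i - 1) ≠ 0) (j : Fin m) :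
    omegaT a b c t x j / ∏ i ∈ univ.erase j, (t i - bval (v i)) =
      betaP b c (!(v j)) j / ∏ i, (t i - bval (flipv j v i))
        + (betaP b c (v j) j + a * (x j * (t j - bval (v j))) / (1 - ∑ i, t i * x i)) /
          ∏ i, (t i - bval (v i)) := by
  have hu : ∀ i, t i - bval (v i) ≠ 0 := fun i hi =>
    ht i (by rw [← sub_bval_mul_sub_bval_not (v i), hi, zero_mul])
  have hE : ∏ i ∈ univ.erase j, (t i - bval (v i)) ≠ 0 := prod_ne_zero_iff.mpr fun i _ => hu i
  rw [prod_sub_bval_flipv, ← mul_prod_erase univ (fun i => t i - bval (v i)) (mem_univ j), omegaT]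
  have h0 := left_ne_zero_of_mul (ht j)
  have h1 := right_ne_zero_of_mul (ht j)
  generalize ∏ i ∈ univ.erase j, (t i - bval (v i)) = E at hE ⊢
  simp only [div_eq_mul_inv _ (1 - ∑ i, t i * x i)]
  generalize (1 - ∑ i, t i * x i)⁻¹ = L
  cases v j <;> simp only [bval, Bool.not_true, Bool.not_false, if_true, Bool.false_eq_true,
    if_false, sub_zero] <;> field_simp <;> ring

/-- **Proposition 4.2, case `v_k = 1` (scalar form).** For every `k`, every `v ∈ {0,1}^m`
with `v_k = 1`, and all `t, x` with
`x_k·(1 − Σ v_i x_i)·(1 − Σ t_i x_i)·∏ t_i(t_i − 1) ≠ 0`: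
`a t_k/((1 − Σ t_i x_i)·∏(t_i − v_i))
  = (1/x_k)·[−β_{0,k}/∏(t_i − (σ_k·v)_i) − β_{1,k}/∏(t_i − v_i) + ω_{T_k}/∏_{i≠k}(t_i − v_i)]
    + (1/(1 − Σ v_i x_i))·[(a − Σβ_v)/∏(t_i − v_i)
        − Σ_j β_{1−v_j,j}/∏(t_i − (σ_j·v)_i) + Σ_j ω_{T_j}/∏_{i≠j}(t_i − v_i)]`. -/
theorem stmt_7 (m : ℕ) (hm : 1 ≤ m) (a : ℂ) (b c : Fin m → ℂ)
    (k : Fin m) (v : Fin m → Bool) (hvk : v k = true) (t x : Fin m → ℂ)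
    (h : x k * (1 - ∑ i, bval (v i) * x i) * (1 - ∑ i, t i * x i) *
        ∏ i, (t i * (t i - 1)) ≠ 0) :
    a * t k / ((1 - ∑ i, t i * x i) * ∏ i, (t i - bval (v i))) =
      (1 / x k) *
        (- betaP b c false k / ∏ i, (t i - bval (flipv k v i))
          - betaP b c true k / ∏ i, (t i - bval (v i))
          + omegaT a b c t x k / ∏ i ∈ univ.erase k, (t i - bval (v i)))
      + (1 / (1 - ∑ i, bval (v i) * x i)) *
        ((a - ∑ i, betaP b c (v i) i) / ∏ i, (t i - bval (v i))
          - ∑ j, betaP b c (!(v j)) j / ∏ i, (t i - bval (flipv j v i))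
          + ∑ j, omegaT a b c t x j / ∏ i ∈ univ.erase j, (t i - bval (v i))) := by
  obtain ⟨h, hp⟩ := mul_ne_zero_iff.mp h
  obtain ⟨h, hL⟩ := mul_ne_zero_iff.mp h
  obtain ⟨hx, hV⟩ := mul_ne_zero_iff.mp h
  have ht : ∀ i, t i * (t i - 1) ≠ 0 := fun i => prod_ne_zero_iff.mp hp i (mem_univ i)
  have hP : ∏ i, (t i - bval (v i)) ≠ 0 := prod_ne_zero_iff.mpr fun i _ hi =>
    ht i (by rw [← sub_bval_mul_sub_bval_not (v i), hi, zero_mul])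
  have hsum : ∑ j, x j * (t j - bval (v j)) = ∑ i, t i * x i - ∑ i, bval (v i) * x i := by
    rw [← sum_sub_distrib]
    exact sum_congr rfl fun i _ => by ring
  simp only [omegaT_div_prod_erase a b c t x v ht, sum_add_distrib, ← sum_div, ← mul_sum, hsum]
  have hbk : bval (v k) = 1 := by simp [hvk, bval]
  rw [hbk, hvk, Bool.not_true]
  generalize ∏ i, (t i - bval (v i)) = P at hP ⊢
  generalize ∑ i, t i * x i = T at hL ⊢
  generalize ∑ i, bval (v i) * x i = V at hV ⊢
  simp only [neg_div]
  generalize betaP b c false k / _ = B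
  generalize ∑ j, betaP b c (!(v j)) j / _ = S
  have hk : -B - betaP b c true k / P +
      (B + (betaP b c true k + a * (x k * (t k - 1)) / (1 - T)) / P) =
      a * (x k * (t k - 1)) / (1 - T) / P := by ring
  rw [hk]
  field_simp
  ring
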